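/- Let 0 ≤ q < 1 and β > 0. For all natural numbers n, m, the monomials z^n and z^m are orthogonal in L²(ν_q) with ‖z^n‖² = β^n [n]_q!; explicitly, (q;q)_∞ · ∑_{j=0}^∞ (q^j/(q;q)_j) · (1/(2π)) ∫_0^{2π} \overline{(r_j e^{iθ})^n} · (r_j e^{iθ})^m dθ = δ_{n,m} · β^n · [n]_q!. -/

import Mathlib

open Complex

/-- The q-integer `[n]_q = 1 + q + ⋯ + q^(n-1)`. -/
noncomputable def qInt (q : ℝ) (n : ℕ) : ℝ := ∑ i ∈ Finset.range n, q ^ i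

/-- The q-factorial `[n]_q! = [1]_q ⋯ [n]_q`. -/
noncomputable def qFact (q : ℝ) (n : ℕ) : ℝ := ∏ i ∈ Finset.range n, qInt q (i + 1)

/-- The q-Pochhammer symbol `(a;q)_n = ∏_{j=0}^{n-1} (1 - a q^j)`. -/
noncomputable def qPoch (a q : ℝ) (n : ℕ) : ℝ := ∏ j ∈ Finset.range n, (1 - a * q ^ j)

/-- The infinite q-Pochhammer symbol `(a;q)_∞ = ∏_{j=0}^{∞} (1 - a q^j)`. -/
noncomputable def qPochInf (a q : ℝ) : ℝ := ∏' j : ℕ, (1 - a * q ^ j)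

/-- The radius `r_j = q^{j/2} √(β/(1-q))`. -/
noncomputable def rRad (q β : ℝ) (j : ℕ) : ℝ := Real.sqrt (q ^ j) * Real.sqrt (β / (1 - q))

lemma one_sub_mul_pow_pos {q : ℝ} (hq0 : 0 ≤ q) (hq1 : q < 1) (j : ℕ) : 0 < 1 - q * q ^ j := by
  rw [← pow_succ']
  exact sub_pos.mpr (pow_lt_one₀ hq0 hq1 j.succ_ne_zero)

lemma qPoch_self_pos {q : ℝ} (hq0 : 0 ≤ q) (hq1 : q < 1) (n : ℕ) : 0 < qPoch q q n :=
  Finset.prod_pos fun j _ ↦ one_sub_mul_pow_pos hq0 hq1 j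

lemma qPoch_succ (a q : ℝ) (n : ℕ) : qPoch a q (n + 1) = qPoch a q n * (1 - a * q ^ n) :=
  Finset.prod_range_succ _ _

lemma summable_norm_neg_mul_pow (a : ℝ) {q : ℝ} (hq0 : 0 ≤ q) (hq1 : q < 1) :
    Summable fun j : ℕ ↦ ‖-(a * q ^ j)‖ := by
  simpa only [norm_neg] using ((summable_geometric_of_lt_one hq0 hq1).mul_left a).norm

lemma tendsto_qPoch (a : ℝ) {q : ℝ} (hq0 : 0 ≤ q) (hq1 : q < 1) :
    Filter.Tendsto (qPoch a q) Filter.atTop (nhds (qPochInf a q)) := by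
  have h := (multipliable_one_add_of_summable
    (summable_norm_neg_mul_pow a hq0 hq1)).hasProd.tendsto_prod_nat
  simp only [← sub_eq_add_neg] at h
  exact h

lemma qPochInf_self_ne_zero {q : ℝ} (hq0 : 0 ≤ q) (hq1 : q < 1) : qPochInf q q ≠ 0 := by
  have h := tprod_one_add_ne_zero_of_summable (f := fun j : ℕ ↦ -(q * q ^ j))
    (fun j ↦ by simpa only [← sub_eq_add_neg] using (one_sub_mul_pow_pos hq0 hq1 j).ne')
    (summable_norm_neg_mul_pow q hq0 hq1)
  simp only [← sub_eq_add_neg] at h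
  exact h

lemma sum_range_succ_pow_div_qPoch {q : ℝ} (hq0 : 0 ≤ q) (hq1 : q < 1) (n : ℕ) :
    ∑ j ∈ Finset.range (n + 1), q ^ j / qPoch q q j = (qPoch q q n)⁻¹ := by
  induction n with
  | zero => simp [qPoch]
  | succ n ih =>
    have h₁ := (qPoch_self_pos hq0 hq1 n).ne'
    have h₂ := (one_sub_mul_pow_pos hq0 hq1 n).ne'
    rw [Finset.sum_range_succ, ih, qPoch_succ]
    field_simp
    ring

/-- Euler's identity for `∑ zʲ / (q;q)_j` at the points `z = q ^ (n + 1)`. -/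
lemma hasSum_pow_div_qPoch_mul_pow {q : ℝ} (hq0 : 0 ≤ q) (hq1 : q < 1) (n : ℕ) :
    HasSum (fun j : ℕ ↦ q ^ j / qPoch q q j * (q ^ j) ^ n) (qPoch q q n / qPochInf q q) := by
  induction n with
  | zero =>
    have h : HasSum (fun j : ℕ ↦ q ^ j / qPoch q q j) (qPochInf q q)⁻¹ := by
      rw [hasSum_iff_tendsto_nat_of_nonneg
        fun j ↦ div_nonneg (pow_nonneg hq0 j) (qPoch_self_pos hq0 hq1 j).le,
        ← Filter.tendsto_add_atTop_iff_nat 1]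
      simp only [sum_range_succ_pow_div_qPoch hq0 hq1]
      exact (tendsto_qPoch q hq0 hq1).inv₀ (qPochInf_self_ne_zero hq0 hq1)
    simpa [qPoch] using h
  | succ n ih =>
    have h : HasSum (fun j : ℕ ↦ (1 - q ^ j) * (q ^ j / qPoch q q j * (q ^ j) ^ n))
        (q * q ^ n * (qPoch q q n / qPochInf q q)) := by
      rw [← hasSum_nat_add_iff' 1]
      convert! ih.mul_left (q * q ^ n) using 1
      · ext j
        have h₁ := (qPoch_self_pos hq0 hq1 j).ne'
        have h₂ := (one_sub_mul_pow_pos hq0 hq1 j).ne'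
        rw [qPoch_succ, pow_succ' q j, mul_pow q]
        field_simp
      · simp
    convert! ih.sub h using 1
    · ext j
      ring
    · rw [qPoch_succ]
      ring

lemma qPoch_self_eq (q : ℝ) (n : ℕ) : qPoch q q n = (1 - q) ^ n * qFact q n := by
  rw [qPoch, qFact, ← Finset.card_range n, ← Finset.prod_const, Finset.card_range,
    ← Finset.prod_mul_distrib]
  exact Finset.prod_congr rfl fun j _ ↦ by rw [qInt, mul_neg_geom_sum, pow_succ']

lemma rRad_sq {q β : ℝ} (hq0 : 0 ≤ q) (hq1 : q < 1) (hβ : 0 ≤ β) (j : ℕ) :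
    rRad q β j ^ 2 = q ^ j * (β / (1 - q)) := by
  rw [rRad, mul_pow, Real.sq_sqrt (pow_nonneg hq0 j),
    Real.sq_sqrt (div_nonneg hβ (sub_nonneg.mpr hq1.le))]

lemma integral_conj_pow_mul_pow_circle (r : ℝ) (n m : ℕ) :
    ∫ θ in (0 : ℝ)..(2 * Real.pi),
      (starRingEnd ℂ) ((r : ℂ) * Complex.exp (θ * Complex.I)) ^ n *
        ((r : ℂ) * Complex.exp (θ * Complex.I)) ^ m
      = if n = m then 2 * (Real.pi : ℂ) * ((r : ℂ) ^ 2) ^ n else 0 := by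
  have h : ∀ θ : ℝ, (starRingEnd ℂ) ((r : ℂ) * Complex.exp (θ * Complex.I)) ^ n *
        ((r : ℂ) * Complex.exp (θ * Complex.I)) ^ m
      = (r : ℂ) ^ (n + m) * Complex.exp (((m : ℂ) - n) * Complex.I * θ) := by
    intro θ
    rw [map_mul, ← Complex.exp_conj, map_mul, conj_ofReal, conj_ofReal, conj_I, mul_pow, mul_pow,
      ← Complex.exp_nat_mul, ← Complex.exp_nat_mul, mul_mul_mul_comm, ← pow_add, ← Complex.exp_add]
    congr 2
    ring
  simp only [h, intervalIntegral.integral_const_mul]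
  split_ifs with hnm
  · subst hnm
    simp
    ring
  · have hc : ((m : ℂ) - n) * Complex.I ≠ 0 :=
      mul_ne_zero (sub_ne_zero.mpr fun h ↦ hnm (Nat.cast_injective h).symm) Complex.I_ne_zero
    have hp : Complex.exp (((m : ℂ) - n) * Complex.I * ((2 * Real.pi : ℝ) : ℂ)) = 1 := by
      rw [Complex.exp_eq_one_iff]
      exact ⟨(m : ℤ) - n, by push_cast; ring⟩
    rw [integral_exp_mul_complex hc, hp]
    simp

/-- Orthogonality of the monomials in the q-deformed Hardy space:
`∫ conj(z^n) z^m dν_q = δ_{n,m} β^n [n]_q!`. -/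
theorem monomials_orthogonal (q β : ℝ) (hq0 : 0 ≤ q) (hq1 : q < 1) (hβ : 0 < β)
    (n m : ℕ) :
    (qPochInf q q : ℂ) *
      ∑' j : ℕ, (((q ^ j / qPoch q q j : ℝ) : ℂ) *
        (((1 : ℝ) / (2 * Real.pi) : ℝ) : ℂ) *
        ∫ θ in (0 : ℝ)..(2 * Real.pi),
          (starRingEnd ℂ) (((rRad q β j : ℝ) : ℂ) * Complex.exp (θ * Complex.I)) ^ n *
            (((rRad q β j : ℝ) : ℂ) * Complex.exp (θ * Complex.I)) ^ m)
      = if n = m then ((β ^ n * qFact q n : ℝ) : ℂ) else 0 := by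
  simp only [integral_conj_pow_mul_pow_circle]
  split_ifs with hnm
  · have hs := ((hasSum_pow_div_qPoch_mul_pow hq0 hq1 n).mul_left ((β / (1 - q)) ^ n)).tsum_eq
    have hterm : ∀ j : ℕ, ((q ^ j / qPoch q q j : ℝ) : ℂ) * (((1 : ℝ) / (2 * Real.pi) : ℝ) : ℂ) *
        (2 * (Real.pi : ℂ) * ((rRad q β j : ℂ) ^ 2) ^ n)
        = (((β / (1 - q)) ^ n * (q ^ j / qPoch q q j * (q ^ j) ^ n) : ℝ) : ℂ) := by
      intro j
      have hr : (rRad q β j : ℂ) ^ 2 = ((q ^ j * (β / (1 - q)) : ℝ) : ℂ) := by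
        rw [← rRad_sq hq0 hq1 hβ.le, ofReal_pow]
      have hπ : (((1 : ℝ) / (2 * Real.pi) : ℝ) : ℂ) * (2 * (Real.pi : ℂ)) = 1 := by
        have := Real.pi_ne_zero
        norm_cast
        field_simp
      rw [hr, mul_assoc, ← mul_assoc _ (2 * (Real.pi : ℂ)), hπ, one_mul]
      norm_cast
      rw [mul_pow]
      ring
    simp only [hterm]
    rw [← ofReal_tsum, hs, ← ofReal_mul, qPoch_self_eq, div_pow]
    congr 1
    have h₁ := qPochInf_self_ne_zero hq0 hq1
    have h₂ : 1 - q ≠ 0 := (sub_pos.mpr hq1).ne'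
    field_simp
  · simp
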